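/- arXiv:1906.00764 — 2 statements merged into one kernel-verified Lean document; each statement's English description precedes it below -/
import Mathlib

section
/- Let X₁, …, X_l be compact metric spaces, let F_i be a dense subset of C(X_i, ℝ) for each i = 1, …, l, and let σ: ℝ → ℝ be continuous and not an algebraic polynomial. Then the set Σ(σ, A^{F₁,…,F_l}) of functions f: X₁ × ⋯ × X_l → ℝ of the form f(x₁, …, x_l) = ∑_{i=1}^n α_i σ(b_i + ∑_{j=1}^l w_{ij} a_{ij}(x_j)) — with n ∈ ℕ, α_i, b_i, w_{ij} ∈ ℝ, and a_{ij} ∈ F_j — is dense in C(X₁ × ⋯ × X_l, ℝ) with the supremum metric. -/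
open Filter Topology MeasureTheory Set
open scoped ContDiff

/-- The functions `ℝ → ℝ` given by a polynomial of degree less than `k`. -/
noncomputable def polynomialFunctionsLT (k : ℕ) : Submodule ℝ (ℝ → ℝ) :=
  (Polynomial.degreeLT ℝ k).map (LinearMap.pi fun t => Polynomial.leval t)

theorem isClosed_polynomialFunctionsLT (k : ℕ) :
    IsClosed (polynomialFunctionsLT k : Set (ℝ → ℝ)) := by
  have : FiniteDimensional ℝ (Polynomial.degreeLT ℝ k) :=
    (Polynomial.degreeLTEquiv ℝ k).symm.finiteDimensional
  have : FiniteDimensional ℝ (polynomialFunctionsLT k) := by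
    unfold polynomialFunctionsLT
    infer_instance
  exact Submodule.closed_of_finiteDimensional _

theorem mem_polynomialFunctionsLT_of_iteratedDeriv_eq_zero {f : ℝ → ℝ} (hf : ContDiff ℝ ∞ f)
    {k : ℕ} (hk : ∀ t, iteratedDeriv k f t = 0) : f ∈ polynomialFunctionsLT k := by
  refine ⟨∑ j ∈ Finset.range k,
    Polynomial.monomial j ((j.factorial : ℝ)⁻¹ * iteratedDeriv j f 0), ?_, ?_⟩
  · refine Submodule.sum_mem _ fun j hj => ?_
    rw [Polynomial.mem_degreeLT]
    exact (Polynomial.degree_monomial_le _ _).trans_lt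
      (by exact_mod_cast Finset.mem_range.1 hj)
  funext t
  simp only [LinearMap.pi_apply, Polynomial.leval_apply, Polynomial.eval_finsetSum,
    Polynomial.eval_monomial]
  rcases k with _ | n
  · simpa using (hk t).symm
  rcases eq_or_ne 0 t with rfl | ht
  · rw [Finset.sum_range_succ']
    simp
  obtain ⟨s, -, hs⟩ := taylor_mean_remainder_lagrange_iteratedDeriv (n := n) ht
    ((hf.of_le (by exact_mod_cast le_top)).contDiffOn)
  rw [hk, taylor_within_apply] at hs
  have hs' : f t = _ := sub_eq_zero.1 (hs.trans (by simp))
  rw [hs']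
  refine Finset.sum_congr rfl fun j _ => ?_
  rw [iteratedDerivWithin_eq_iteratedDeriv (s := uIcc 0 t)
    (uniqueDiffOn_Icc (by simpa using ht.symm))
    (hf.contDiffAt.of_le (by exact_mod_cast le_top)) left_mem_uIcc]
  simp only [sub_zero, smul_eq_mul]
  ring

theorem integral_mem_of_isClosed {α E : Type*} [MeasurableSpace α] {μ : Measure α}
    [NormedAddCommGroup E] [NormedSpace ℝ E] [CompleteSpace E] {V : Submodule ℝ E}
    (hV : IsClosed (V : Set E)) {Φ : α → E} (hΦ : ∀ s, Φ s ∈ V) : ∫ s, Φ s ∂μ ∈ V := by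
  have : CompleteSpace V := hV.completeSpace_coe
  have h := V.subtypeₗᵢ.integral_comp_comm (μ := μ) fun s => (⟨Φ s, hΦ s⟩ : V)
  exact h.symm ▸ Subtype.prop _

section

variable {Y : Type*} [TopologicalSpace Y] [CompactSpace Y]

/-- If all `f ∘ (w g + b)` lie in a closed subspace that contains the powers of `g` below `k`, then
the subspace contains the `k`-th Taylor coefficient `f⁽ᵏ⁾(b) gᵏ` of `w ↦ f ∘ (w g + b)`. -/
theorem iteratedDeriv_smul_pow_mem {V : Submodule ℝ C(Y, ℝ)} (hV : IsClosed (V : Set C(Y, ℝ)))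
    {g : C(Y, ℝ)} {f : C(ℝ, ℝ)} {k : ℕ} (hf : ContDiff ℝ k f)
    (hfV : ∀ w b : ℝ, f.comp (w • g + ContinuousMap.const Y b) ∈ V)
    (hg : ∀ j < k, g ^ j ∈ V) (b : ℝ) :
    ((k.factorial : ℝ)⁻¹ * iteratedDeriv k f b) • g ^ k ∈ V := by
  rw [← SetLike.mem_coe, ← hV.closure_eq, Metric.mem_closure_iff]
  intro ε hε
  have hMk : 0 ≤ ‖g‖ ^ k := by positivity
  set η := ε / (‖g‖ ^ k + 1) with hη
  have hη0 : 0 < η := by positivity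
  obtain ⟨δ, hδ, hT⟩ := Metric.eventually_nhds_iff.1
    ((taylor_isLittleO_univ (x₀ := b) hf).def hη0)
  set w := δ / (‖g‖ + 1) with hw
  have hw0 : 0 < w := by positivity
  refine ⟨(w ^ k)⁻¹ • (f.comp (w • g + ContinuousMap.const Y b) -
    ∑ j ∈ Finset.range k, ((j.factorial : ℝ)⁻¹ * iteratedDeriv j f b * w ^ j) • g ^ j), ?_, ?_⟩
  · refine V.smul_mem _ (V.sub_mem (hfV _ _) (V.sum_mem fun j hj => V.smul_mem _ ?_))
    exact hg j (Finset.mem_range.1 hj)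
  rw [ContinuousMap.dist_lt_iff hε]
  intro x
  have hgx : |g x| ≤ ‖g‖ := g.norm_coe_le_norm x
  have hwg : |w * g x| < δ := by
    rw [abs_mul, abs_of_pos hw0]
    calc w * |g x| ≤ w * ‖g‖ := by gcongr
      _ < w * (‖g‖ + 1) := by gcongr; linarith
      _ = δ := by rw [hw]; field_simp
  have h := hT (y := w * g x + b) (by simpa [Real.dist_eq] using hwg)
  rw [taylor_within_apply] at h
  simp only [iteratedDerivWithin_univ, Finset.sum_range_succ, add_sub_cancel_right,
    smul_eq_mul, Real.norm_eq_abs] at h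
  have key : ((k.factorial : ℝ)⁻¹ * iteratedDeriv k f b) * g x ^ k - (w ^ k)⁻¹ *
      (f (w * g x + b) -
        ∑ j ∈ Finset.range k, ((j.factorial : ℝ)⁻¹ * iteratedDeriv j f b * w ^ j) * g x ^ j) =
      -((w ^ k)⁻¹ * (f (w * g x + b) -
        (∑ j ∈ Finset.range k, (j.factorial : ℝ)⁻¹ * (w * g x) ^ j * iteratedDeriv j f b +
          (k.factorial : ℝ)⁻¹ * (w * g x) ^ k * iteratedDeriv k f b))) := by
    have : ∀ j, (j.factorial : ℝ)⁻¹ * (w * g x) ^ j * iteratedDeriv j f b =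
        ((j.factorial : ℝ)⁻¹ * iteratedDeriv j f b * w ^ j) * g x ^ j := fun j => by ring
    simp only [this]
    have hwk : w ^ k ≠ 0 := by positivity
    field_simp
    ring
  rw [Real.dist_eq]
  simp only [ContinuousMap.smul_apply, ContinuousMap.sub_apply, ContinuousMap.comp_apply,
    ContinuousMap.add_apply, ContinuousMap.const_apply, ContinuousMap.sum_apply,
    ContinuousMap.pow_apply, smul_eq_mul]
  rw [key, abs_neg, abs_mul, abs_of_pos (by positivity : 0 < (w ^ k)⁻¹)]
  calc _ ≤ (w ^ k)⁻¹ * (η * |(w * g x) ^ k|) := by gcongr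
    _ = η * |g x| ^ k := by
      rw [mul_pow, abs_mul, abs_pow, abs_pow, abs_of_pos hw0]
      field_simp
    _ ≤ η * ‖g‖ ^ k := by gcongr
    _ < η * (‖g‖ ^ k + 1) := by gcongr; linarith
    _ = ε := by rw [hη]; field_simp

/-- A closed subspace containing all `f ∘ (w g + b)` contains the same compositions with
mollifications of `f`. -/
theorem convolution_comp_mem {V : Submodule ℝ C(Y, ℝ)} (hV : IsClosed (V : Set C(Y, ℝ)))
    {g : C(Y, ℝ)} {f : C(ℝ, ℝ)} (hfV : ∀ w b : ℝ, f.comp (w • g + ContinuousMap.const Y b) ∈ V)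
    {φ : ℝ → ℝ} (hφ : Continuous φ) (hφc : HasCompactSupport φ) {F : C(ℝ, ℝ)}
    (hF : ∀ t, F t = convolution φ f (ContinuousLinearMap.lsmul ℝ ℝ) volume t) (w b : ℝ) :
    F.comp (w • g + ContinuousMap.const Y b) ∈ V := by
  set Φ : ℝ → C(Y, ℝ) :=
    fun s => φ s • f.comp (w • g + ContinuousMap.const Y (b - s)) with hΦ
  have hΦc : Continuous Φ := by
    refine hφ.smul ((ContinuousMap.continuous_postcomp f).comp ?_)
    exact continuous_const.add (ContinuousMap.continuous_const'.comp (by fun_prop))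
  have hΦi : Integrable Φ := hΦc.integrable_of_hasCompactSupport hφc.smul_right
  have hint : F.comp (w • g + ContinuousMap.const Y b) = ∫ s, Φ s := by
    ext x
    rw [ContinuousMap.integral_apply hΦi]
    simp [hF, convolution_def, hΦ, add_sub_assoc]
  rw [hint]
  exact integral_mem_of_isClosed hV fun s => V.smul_mem _ (hfV _ _)

/-- A closed subspace of `C(Y, ℝ)` containing all `σ ∘ (w g + b)`, for a continuous non-polynomial
`σ`, contains all powers of `g`. -/
theorem pow_mem_of_comp_mem {V : Submodule ℝ C(Y, ℝ)} (hV : IsClosed (V : Set C(Y, ℝ)))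
    {g : C(Y, ℝ)} {σ : C(ℝ, ℝ)} (hσ : ¬ ∃ q : Polynomial ℝ, ∀ t : ℝ, σ t = q.eval t)
    (hσV : ∀ w b : ℝ, σ.comp (w • g + ContinuousMap.const Y b) ∈ V) (k : ℕ) : g ^ k ∈ V := by
  induction k using Nat.strong_induction_on with
  | _ k ih =>
    by_contra hk
    refine hσ ?_
    let φ : ℕ → ContDiffBump (0 : ℝ) := fun n =>
      ⟨1 / (n + 1) / 2, 1 / (n + 1), by positivity, half_lt_self (by positivity)⟩
    have hsmooth : ∀ n, ContDiff ℝ ∞ (convolution ((φ n).normed volume) σ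
        (ContinuousLinearMap.lsmul ℝ ℝ) volume) := fun n =>
      (φ n).hasCompactSupport_normed.contDiff_convolution_left _ (φ n).contDiff_normed
        σ.continuous.locallyIntegrable
    have hpoly : ∀ n, convolution ((φ n).normed volume) σ
        (ContinuousLinearMap.lsmul ℝ ℝ) volume ∈ polynomialFunctionsLT k := by
      intro n
      refine mem_polynomialFunctionsLT_of_iteratedDeriv_eq_zero (hsmooth n) fun b => ?_
      by_contra hb
      refine hk ?_
      have hmem := iteratedDeriv_smul_pow_mem hV (f := ⟨_, (hsmooth n).continuous⟩) (k := k)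
        ((hsmooth n).of_le (by exact_mod_cast le_top))
        (convolution_comp_mem hV hσV (φ n).continuous_normed (φ n).hasCompactSupport_normed
          fun _ => rfl) ih b
      exact (V.smul_mem_iff (mul_ne_zero (by positivity) hb)).1 hmem
    have hlim : Tendsto (fun n => convolution ((φ n).normed volume) σ
        (ContinuousLinearMap.lsmul ℝ ℝ) volume) atTop (𝓝 (σ : ℝ → ℝ)) :=
      tendsto_pi_nhds.2 fun t => ContDiffBump.convolution_tendsto_right_of_continuous
        tendsto_one_div_add_atTop_nhds_zero_nat σ.continuous t
    obtain ⟨q, -, hq⟩ := (isClosed_polynomialFunctionsLT k).mem_of_tendsto hlim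
      (Eventually.of_forall hpoly)
    exact ⟨q, fun t => (congrFun hq t).symm⟩

theorem exp_mem_of_comp_mem {V : Submodule ℝ C(Y, ℝ)} (hV : IsClosed (V : Set C(Y, ℝ)))
    {g : C(Y, ℝ)} {σ : C(ℝ, ℝ)} (hσ : ¬ ∃ q : Polynomial ℝ, ∀ t : ℝ, σ t = q.eval t)
    (hσV : ∀ w b : ℝ, σ.comp (w • g + ContinuousMap.const Y b) ∈ V) :
    NormedSpace.exp g ∈ V := by
  rw [NormedSpace.exp_eq_tsum ℝ]
  exact tsum_mem hV fun k => V.smul_mem _ (pow_mem_of_comp_mem hV hσ hσV k)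

/-- If the values of `T` separate the points of `Y`, then a closed subspace of `C(Y, ℝ)` containing
all `exp (T a)` is everything. -/
theorem eq_top_of_exp_mem {E : Type*} [AddCommGroup E] (T : E →+ C(Y, ℝ))
    (hT : ∀ x y : Y, x ≠ y → ∃ a, T a x ≠ T a y)
    {V : Submodule ℝ C(Y, ℝ)} (hV : IsClosed (V : Set C(Y, ℝ)))
    (hexp : ∀ a, NormedSpace.exp (T a) ∈ V) : V = ⊤ := by
  let M : Submonoid C(Y, ℝ) :=
    { carrier := range fun a => NormedSpace.exp (T a)
      one_mem' := ⟨0, by simp⟩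
      mul_mem' := by
        rintro _ _ ⟨a, rfl⟩ ⟨b, rfl⟩
        exact ⟨a + b, by simp [NormedSpace.exp_add]⟩ }
  have hexp_apply : ∀ (h : C(Y, ℝ)) (x : Y), NormedSpace.exp h x = Real.exp (h x) := by
    intro h x
    rw [Real.exp_eq_exp_ℝ]
    exact NormedSpace.map_exp (ContinuousMap.evalAlgHom ℝ ℝ x)
      (continuous_eval_const x) h
  have hsep : (Algebra.adjoin ℝ (M : Set C(Y, ℝ))).SeparatesPoints := by
    intro x y hxy
    obtain ⟨a, ha⟩ := hT x y hxy
    refine ⟨_, ⟨NormedSpace.exp (T a), Algebra.subset_adjoin ⟨a, rfl⟩, rfl⟩, ?_⟩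
    simpa [hexp_apply] using ha
  have hle : Subalgebra.toSubmodule (Algebra.adjoin ℝ (M : Set C(Y, ℝ))) ≤ V := by
    rw [Algebra.adjoin_eq_span, Submonoid.closure_eq, Submodule.span_le]
    rintro _ ⟨a, rfl⟩
    exact hexp a
  refine eq_top_iff.2 fun f _ => ?_
  have hf := ContinuousMap.continuousMap_mem_subalgebra_closure_of_separatesPoints _ hsep f
  exact closure_minimal (fun _ h => hle h) hV hf

end

/-- The additive map sending `(a_j)` to the function `x ↦ ∑ j, a_j (x_j)`. -/
def sumCoordinates {ι : Type*} [Fintype ι] (X : ι → Type*) [∀ j, TopologicalSpace (X j)] :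
    ((j : ι) → C(X j, ℝ)) →+ C((j : ι) → X j, ℝ) where
  toFun a := ∑ j, (a j).comp (ContinuousMap.eval j)
  map_zero' := by ext; simp
  map_add' a b := by ext; simp [Finset.sum_add_distrib]

theorem sumCoordinates_apply {ι : Type*} [Fintype ι] (X : ι → Type*)
    [∀ j, TopologicalSpace (X j)] (a : (j : ι) → C(X j, ℝ)) (x : (j : ι) → X j) :
    sumCoordinates X a x = ∑ j, a j (x j) := by
  simp [sumCoordinates]

theorem continuous_sumCoordinates {ι : Type*} [Fintype ι] (X : ι → Type*)
    [∀ j, TopologicalSpace (X j)] : Continuous (sumCoordinates X) :=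
  continuous_finsetSum _ fun j _ =>
    (ContinuousMap.continuous_precomp _).comp (continuous_apply j)


/-- Universal approximation theorem for finite products: if F_j is dense in
C(X_j, ℝ) for each j and σ is continuous and non-polynomial, then functions of
the form x ↦ ∑_{i=1}^n α_i σ(b_i + ∑_{j=1}^l w_{ij} a_{ij}(x_j)), with
a_{ij} ∈ F_j, are dense in C(X₁ × ⋯ × X_l, ℝ) (sup metric). -/
theorem stmt_10 {l : ℕ} (X : Fin l → Type*)
    [∀ j, MetricSpace (X j)] [∀ j, CompactSpace (X j)]
    (F : (j : Fin l) → Set C(X j, ℝ)) (hF : ∀ j, Dense (F j))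
    (σ : ℝ → ℝ) (hσ_cont : Continuous σ)
    (hσ_nonpoly : ¬ ∃ q : Polynomial ℝ, ∀ t : ℝ, σ t = q.eval t)
    (f : ((j : Fin l) → X j) → ℝ) (hf : Continuous f) :
    ∀ ε > 0, ∃ (n : ℕ) (α : Fin n → ℝ) (b : Fin n → ℝ)
      (w : Fin n → Fin l → ℝ) (a : Fin n → (j : Fin l) → C(X j, ℝ)),
      (∀ i j, a i j ∈ F j) ∧
      ∀ x : (j : Fin l) → X j,
        |f x - ∑ i, α i * σ (b i + ∑ j, w i j * a i j (x j))| < ε := by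
  intro ε hε
  let s : C(ℝ, ℝ) := ⟨σ, hσ_cont⟩
  let S : Set C((j : Fin l) → X j, ℝ) :=
    {h | ∃ (b : ℝ) (w : Fin l → ℝ) (a : (j : Fin l) → C(X j, ℝ)), (∀ j, a j ∈ F j) ∧
      h = s.comp (ContinuousMap.const _ b + sumCoordinates X fun j => w j • a j)}
  let V : Submodule ℝ C((j : Fin l) → X j, ℝ) := (Submodule.span ℝ S).topologicalClosure
  have hV : IsClosed (V : Set C((j : Fin l) → X j, ℝ)) :=
    (Submodule.span ℝ S).isClosed_topologicalClosure
  have hmem : ∀ (b : ℝ) (a : (j : Fin l) → C(X j, ℝ)),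
      s.comp (sumCoordinates X a + ContinuousMap.const _ b) ∈ V := by
    intro b a
    have hcont : Continuous fun a : (j : Fin l) → C(X j, ℝ) =>
        s.comp (sumCoordinates X a + ContinuousMap.const _ b) :=
      (ContinuousMap.continuous_postcomp s).comp
        ((continuous_sumCoordinates X).add continuous_const)
    refine closure_minimal (s := univ.pi F) ?_ (hV.preimage hcont)
      (dense_pi univ (fun j _ => hF j) a)
    intro a ha
    refine Submodule.le_topologicalClosure _
      (Submodule.subset_span ⟨b, 1, a, fun j => ha j trivial, ?_⟩)
    simp [add_comm]
  have hVtop : V = ⊤ := by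
    refine eq_top_of_exp_mem (sumCoordinates X) (fun x y hxy => ?_) hV fun a =>
      exp_mem_of_comp_mem hV (σ := s) hσ_nonpoly fun w b => ?_
    · obtain ⟨j, hj⟩ := Function.ne_iff.1 hxy
      refine ⟨Pi.single j ⟨fun z => dist z (y j), by fun_prop⟩, ?_⟩
      have hval : ∀ z, sumCoordinates X
          (Pi.single j ⟨fun z => dist z (y j), by fun_prop⟩) z = dist (z j) (y j) := by
        intro z
        rw [sumCoordinates_apply, Finset.sum_eq_single j]
        · simp
        · intro i _ hi
          simp [Pi.single_eq_of_ne hi]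
        · simp
      rw [hval, hval, dist_self]
      exact dist_ne_zero.2 hj
    · convert hmem b (w • a) using 3
      ext x
      simp [sumCoordinates_apply, Finset.mul_sum]
  have hfV : (⟨f, hf⟩ : C((j : Fin l) → X j, ℝ)) ∈ closure (Submodule.span ℝ S : Set _) := by
    have : (⟨f, hf⟩ : C((j : Fin l) → X j, ℝ)) ∈ V := hVtop ▸ Submodule.mem_top
    exact this
  obtain ⟨h, hh, hdist⟩ := Metric.mem_closure_iff.1 hfV ε hε
  obtain ⟨n, α, g, rfl⟩ := Submodule.mem_span_set'.1 hh
  choose b w a ha hg using fun i => (g i).2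
  refine ⟨n, α, b, w, a, ha, fun x => ?_⟩
  have hx := (ContinuousMap.dist_lt_iff hε).1 hdist x
  rw [Real.dist_eq] at hx
  simpa [hg, sumCoordinates_apply, s] using hx
end

section
/- Let X be a compact subset of ℝ^d and let P be a compact (in the weak-* topology) set of Borel probability measures on X. Let σ: ℝ → ℝ be continuous and not an algebraic polynomial. Then the class of three-layer multi-instance neural networks, i.e. functions of the form f(p) = W₁ σ(W₂ (∫_X σ(W₃ x + b₃) dp(x)) + b₂) + b₁ — where W₃ ∈ ℝ^{k×d}, b₃ ∈ ℝ^k, W₂ ∈ ℝ^{m×k}, b₂ ∈ ℝ^m, W₁ ∈ ℝ^{1×m}, b₁ ∈ ℝ, k, m ∈ ℕ, σ is applied coordinate-wise, and the integral of the ℝ^k-valued integrand is taken coordinate-wise — is dense in C(P, ℝ): every continuous function f: P → ℝ can be approximated uniformly on P to arbitrary precision by such networks. -/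
open MeasureTheory
open Filter Topology ContinuousLinearMap
open scoped Convolution ContDiff

/-- A smooth function whose `n`-th derivative vanishes is a polynomial of degree less than `n`. -/
theorem exists_polynomial_of_iteratedDeriv_eq_zero (n : ℕ) :
    ∀ {g : ℝ → ℝ}, ContDiff ℝ ∞ g → (∀ x, iteratedDeriv n g x = 0) →
      ∃ q : Polynomial ℝ, q.degree < n ∧ ∀ x, g x = q.eval x := by
  suffices h : ∀ {g : ℝ → ℝ}, ContDiff ℝ ∞ g → (∀ x, iteratedDeriv n g x = 0) →
      ∃ c : ℕ → ℝ, ∀ x, g x = ∑ i : Fin n, c i * x ^ (i : ℕ) by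
    intro g hg hn
    obtain ⟨c, hc⟩ := h hg hn
    refine ⟨∑ i : Fin n, Polynomial.C (c i) * Polynomial.X ^ (i : ℕ),
      Polynomial.degree_sum_fin_lt fun i : Fin n => c i, fun x => ?_⟩
    simp [hc, Polynomial.eval_finsetSum]
  induction n with
  | zero =>
    intro g _ hn
    exact ⟨0, fun x => by simpa using hn x⟩
  | succ n ih =>
    intro g hg hn
    obtain ⟨c, hc⟩ := ih (g := deriv g) (contDiff_infty_iff_deriv.1 hg).2
      fun x => by rw [← iteratedDeriv_succ']; exact hn x
    let s : ℝ → ℝ := fun x => ∑ i : Fin n, c i / ((i : ℕ) + 1) * x ^ ((i : ℕ) + 1)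
    have hs : ∀ x, HasDerivAt s (deriv g x) x := by
      intro x
      rw [hc]
      refine HasDerivAt.fun_sum fun i _ => ?_
      have h := (hasDerivAt_pow ((i : ℕ) + 1) x).const_mul (c i / ((i : ℕ) + 1))
      refine h.congr_deriv ?_
      have : ((i : ℕ) : ℝ) + 1 ≠ 0 := by positivity
      rw [Nat.add_sub_cancel]
      push_cast
      field_simp
    have hg' : ∀ x, HasDerivAt g (deriv g x) x := fun x =>
      ((contDiff_infty_iff_deriv.1 hg).1 x).hasDerivAt
    have hconst := is_const_of_deriv_eq_zero (f := fun x => g x - s x)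
      (fun x => ((hg' x).sub (hs x)).differentiableAt)
      (fun x => ((hg' x).sub (hs x)).deriv.trans (sub_self _))
    refine ⟨fun i => if i = 0 then g 0 else c (i - 1) / i, fun x => ?_⟩
    have := hconst x 0
    simp only [s] at this
    rw [Fin.sum_univ_succ]
    simp at this ⊢
    linarith

/-- A pointwise limit of polynomials of degree less than `n` is a polynomial. -/
theorem exists_polynomial_of_tendsto {n : ℕ} {q : ℕ → Polynomial ℝ} {f : ℝ → ℝ}
    (hq : ∀ i, (q i).degree < n)
    (hf : ∀ x, Tendsto (fun i => (q i).eval x) atTop (𝓝 (f x))) :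
    ∃ p : Polynomial ℝ, ∀ x, f x = p.eval x := by
  have hinj : Set.InjOn (fun i : ℕ => (i : ℝ)) (Finset.range n) := Nat.cast_injective.injOn
  refine ⟨Lagrange.interpolate (Finset.range n) (fun i : ℕ => (i : ℝ)) fun i => f i, fun x => ?_⟩
  refine tendsto_nhds_unique (hf x) ?_
  have h : ∀ i, (q i).eval x = ∑ j ∈ Finset.range n, (q i).eval (j : ℝ) *
      (Lagrange.basis (Finset.range n) (fun i : ℕ => (i : ℝ)) j).eval x := by
    intro i
    conv_lhs => rw [Lagrange.eq_interpolate (f := q i) hinj (by simpa using hq i)]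
    simp [Lagrange.interpolate_apply, Polynomial.eval_finsetSum]
  simp only [h, Lagrange.interpolate_apply, Polynomial.eval_finsetSum, Polynomial.eval_mul,
    Polynomial.eval_C]
  exact tendsto_finsetSum _ fun j _ => (hf j).mul_const _

theorem contDiff_normed_convolution (φ : ContDiffBump (0 : ℝ)) {σ : ℝ → ℝ} (hσ : Continuous σ) :
    ContDiff ℝ ∞ (φ.normed volume ⋆[lsmul ℝ ℝ, volume] σ) :=
  φ.hasCompactSupport_normed.contDiff_convolution_left _ φ.contDiff_normed hσ.locallyIntegrable

/-- If `σ` is not a polynomial, then some mollification of `σ` has nonzero `n`-th derivative. -/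
theorem exists_iteratedDeriv_convolution_ne_zero {σ : ℝ → ℝ} (hσ : Continuous σ)
    (hpoly : ¬ ∃ q : Polynomial ℝ, ∀ t : ℝ, σ t = q.eval t) (n : ℕ) :
    ∃ (φ : ContDiffBump (0 : ℝ)) (b : ℝ),
      iteratedDeriv n (φ.normed volume ⋆[lsmul ℝ ℝ, volume] σ) b ≠ 0 := by
  by_contra! h
  choose q hq hqe using fun φ : ContDiffBump (0 : ℝ) =>
    exists_polynomial_of_iteratedDeriv_eq_zero n (contDiff_normed_convolution φ hσ) (h φ)
  let φ : ℕ → ContDiffBump (0 : ℝ) := fun i =>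
    ⟨1 / ((i : ℝ) + 1) / 2, 1 / ((i : ℝ) + 1), by positivity, half_lt_self (by positivity)⟩
  refine hpoly (exists_polynomial_of_tendsto (fun i => hq (φ i)) fun x => ?_)
  simp only [← hqe]
  exact ContDiffBump.convolution_tendsto_right_of_continuous
    tendsto_one_div_add_atTop_nhds_zero_nat hσ x

theorem Submodule.integral_mem_of_isClosed {E : Type*} [NormedAddCommGroup E] [NormedSpace ℝ E]
    [CompleteSpace E] {M : Submodule ℝ E} (hM : IsClosed (M : Set E)) {F : ℝ → E}
    (hF : Continuous F) (hFc : HasCompactSupport F) (hmem : ∀ s, F s ∈ M) : ∫ s, F s ∈ M := by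
  have : CompleteSpace M := hM.completeSpace_coe
  let G : ℝ → M := fun s => ⟨F s, hmem s⟩
  have hG : Continuous G := hF.subtype_mk _
  have hGc : HasCompactSupport G := hFc.mono fun s hs h => hs (Subtype.ext h)
  have h := M.subtypeL.integral_comp_comm
    (hG.integrable_of_hasCompactSupport hGc (μ := volume))
  have h' : ∫ s, F s = M.subtypeL (∫ s, G s) := h
  rw [h']
  exact (∫ s, G s).2

theorem Submodule.mem_of_hasDerivAt {E : Type*} [NormedAddCommGroup E] [NormedSpace ℝ E]
    {M : Submodule ℝ E} (hM : IsClosed (M : Set E)) {H : ℝ → E} {H' : E} {x : ℝ}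
    (hH : HasDerivAt H H' x) (hmem : ∀ s, H s ∈ M) : H' ∈ M :=
  hM.mem_of_tendsto (hasDerivAt_iff_tendsto_slope.1 hH) <| Eventually.of_forall fun y =>
    M.smul_mem _ (M.sub_mem (hmem y) (hmem x))

section Approximation

variable {K : Type*} [TopologicalSpace K]

/-- The function `x ↦ g (w * v x + b)`. -/
def ridge (g : C(ℝ, ℝ)) (v : C(K, ℝ)) (w b : ℝ) : C(K, ℝ) :=
  g.comp (w • v + ContinuousMap.const K b)

@[simp]
theorem ridge_apply (g : C(ℝ, ℝ)) (v : C(K, ℝ)) (w b : ℝ) (x : K) :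
    ridge g v w b x = g (w * v x + b) := rfl

variable [CompactSpace K]

theorem continuous_ridge (g : C(ℝ, ℝ)) (v : C(K, ℝ)) (b : ℝ) :
    Continuous fun w => ridge g v w b :=
  (ContinuousMap.continuous_postcomp g).comp (by fun_prop)

theorem continuous_ridge_bias (g : C(ℝ, ℝ)) (v : C(K, ℝ)) (w : ℝ) :
    Continuous fun b => ridge g v w b :=
  (ContinuousMap.continuous_postcomp g).comp
    (continuous_const.add (ContinuousMap.continuous_const' (X := K)))

theorem hasDerivAt_ridge (u v : C(K, ℝ)) {g g' : C(ℝ, ℝ)} (hg : ∀ t, HasDerivAt g (g' t) t)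
    (w b : ℝ) :
    HasDerivAt (fun w => u * ridge g v w b) (u * v * ridge g' v w b) w := by
  have hc : Continuous fun w => u * v * ridge g' v w b :=
    continuous_const.mul (continuous_ridge g' v b)
  have hint : ∀ w, (∫ s in (0 : ℝ)..w, u * v * ridge g' v s b) + u * ridge g v 0 b =
      u * ridge g v w b := by
    intro w
    ext x
    have h1 := (ContinuousMap.evalCLM ℝ x).intervalIntegral_comp_comm
      (hc.intervalIntegrable (μ := volume) 0 w)
    have h2 : ∀ s ∈ Set.uIcc 0 w, HasDerivAt (fun s => u x * g (s * v x + b))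
        (u x * v x * g' (s * v x + b)) s := by
      intro s _
      have h3 : HasDerivAt (fun s => s * v x + b) (v x) s := by
        simpa using ((hasDerivAt_id s).mul_const (v x)).add_const b
      have := ((hg (s * v x + b)).comp s h3).const_mul (u x)
      exact this.congr_deriv (by ring)
    have h4 := intervalIntegral.integral_eq_sub_of_hasDerivAt h2
      (Continuous.intervalIntegrable (by fun_prop) _ _)
    simp only [ContinuousMap.evalCLM_apply, ContinuousMap.mul_apply, ridge_apply] at h1
    rw [h1] at h4
    simp [h4]
  have := (intervalIntegral.integral_hasDerivAt_right (hc.intervalIntegrable 0 w)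
    hc.aestronglyMeasurable.stronglyMeasurableAtFilter hc.continuousAt).add_const
      (u * ridge g v 0 b)
  simpa only [hint] using this

theorem ridge_convolution_mem {M : Submodule ℝ C(K, ℝ)} (hM : IsClosed (M : Set C(K, ℝ)))
    {σ : C(ℝ, ℝ)} {v : C(K, ℝ)} {w : ℝ} (hmem : ∀ b, ridge σ v w b ∈ M)
    (φ : ContDiffBump (0 : ℝ)) {g : C(ℝ, ℝ)}
    (hg : ⇑g = φ.normed volume ⋆[lsmul ℝ ℝ, volume] σ) (b : ℝ) : ridge g v w b ∈ M := by
  have hc : Continuous fun s => φ.normed volume s • ridge σ v w (b - s) :=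
    φ.continuous_normed.smul ((continuous_ridge_bias σ v w).comp (by fun_prop))
  have hs : HasCompactSupport fun s => φ.normed volume s • ridge σ v w (b - s) :=
    φ.hasCompactSupport_normed.smul_right
  have h := Submodule.integral_mem_of_isClosed hM hc hs fun s => M.smul_mem _ (hmem _)
  convert h
  ext x
  have h1 := (ContinuousMap.evalCLM ℝ x).integral_comp_comm
    (hc.integrable_of_hasCompactSupport hs (μ := volume))
  simp only [ContinuousMap.evalCLM_apply] at h1
  rw [← h1, ridge_apply, hg, convolution_def]
  simp [add_sub_assoc]

/-- A closed subspace containing all ridge functions `σ (w * v + b)` with `σ` continuous and not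
polynomial contains every power of `v`. -/
theorem pow_mem_of_ridge_mem {M : Submodule ℝ C(K, ℝ)} (hM : IsClosed (M : Set C(K, ℝ)))
    {σ : C(ℝ, ℝ)} (hpoly : ¬ ∃ q : Polynomial ℝ, ∀ t : ℝ, σ t = q.eval t) {v : C(K, ℝ)}
    (hmem : ∀ w b, ridge σ v w b ∈ M) (n : ℕ) : v ^ n ∈ M := by
  obtain ⟨φ, b, hb⟩ := exists_iteratedDeriv_convolution_ne_zero σ.continuous hpoly n
  have hsm := contDiff_normed_convolution φ σ.continuous
  set g := φ.normed volume ⋆[lsmul ℝ ℝ, volume] σ with hg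
  let D : ℕ → C(ℝ, ℝ) := fun k =>
    ⟨iteratedDeriv k g, hsm.continuous_iteratedDeriv k (by exact_mod_cast le_top)⟩
  have hD : ∀ k t, HasDerivAt (D k) (D (k + 1) t) t := by
    intro k t
    have := (hsm.differentiable_iteratedDeriv k (by exact_mod_cast WithTop.coe_lt_top k)
      t).hasDerivAt
    simpa [D, iteratedDeriv_succ] using this
  have key : ∀ k w, v ^ k * ridge (D k) v w b ∈ M := by
    intro k
    induction k with
    | zero =>
      intro w
      rw [pow_zero, one_mul]
      exact ridge_convolution_mem hM (hmem w) φ (by simp [D, hg]) b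
    | succ k ih =>
      intro w
      rw [pow_succ]
      exact Submodule.mem_of_hasDerivAt hM (hasDerivAt_ridge (v ^ k) v (hD k) w b) ih
  have h0 : v ^ n * ridge (D n) v 0 b = iteratedDeriv n g b • v ^ n := by
    ext x
    simp [D, mul_comm]
  have := M.smul_mem (iteratedDeriv n g b)⁻¹ (h0 ▸ key n 0)
  rwa [smul_smul, inv_mul_cancel₀ hb, one_smul] at this

/-- Universal approximation by one hidden layer over a point-separating space of features. -/
theorem dense_span_comp_add_const {σ : C(ℝ, ℝ)}
    (hpoly : ¬ ∃ q : Polynomial ℝ, ∀ t : ℝ, σ t = q.eval t) (V : Submodule ℝ C(K, ℝ))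
    (hV : ∀ x y : K, x ≠ y → ∃ v ∈ V, v x ≠ v y) :
    (Submodule.span ℝ (Set.range fun a : V × ℝ =>
      σ.comp ((a.1 : C(K, ℝ)) + ContinuousMap.const K a.2))).topologicalClosure = ⊤ := by
  set M := (Submodule.span ℝ (Set.range fun a : V × ℝ =>
      σ.comp ((a.1 : C(K, ℝ)) + ContinuousMap.const K a.2))).topologicalClosure with hMdef
  have hM : IsClosed (M : Set C(K, ℝ)) := Submodule.isClosed_topologicalClosure _
  have hexp : ∀ v ∈ V, NormedSpace.exp v ∈ M := by
    intro v hv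
    have hpow := pow_mem_of_ridge_mem hM hpoly (v := v) fun w b =>
      Submodule.le_topologicalClosure _ (Submodule.subset_span ⟨(⟨w • v, V.smul_mem w hv⟩, b), rfl⟩)
    exact hM.mem_of_tendsto (NormedSpace.exp_series_hasSum_exp' (𝕂 := ℝ) v) <|
      Eventually.of_forall fun s => M.sum_mem fun n _ => M.smul_mem _ (hpow n)
  let S : Submonoid C(K, ℝ) :=
    { carrier := {u | ∃ v ∈ V, NormedSpace.exp v = u}
      one_mem' := ⟨0, V.zero_mem, NormedSpace.exp_zero⟩
      mul_mem' := by
        rintro _ _ ⟨v, hv, rfl⟩ ⟨v', hv', rfl⟩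
        exact ⟨v + v', V.add_mem hv hv', NormedSpace.exp_add⟩ }
  have hle : Subalgebra.toSubmodule (Algebra.adjoin ℝ (S : Set C(K, ℝ))) ≤ M := by
    rw [Algebra.adjoin_eq_span_of_subset _
        (by rw [Submonoid.closure_eq]; exact Submodule.subset_span),
      Submodule.span_le]
    rintro _ ⟨v, hv, rfl⟩
    exact hexp v hv
  have hsep : (Algebra.adjoin ℝ (S : Set C(K, ℝ))).SeparatesPoints := by
    intro x y hxy
    obtain ⟨v, hv, hne⟩ := hV x y hxy
    refine ⟨_, ⟨NormedSpace.exp v, Algebra.subset_adjoin ⟨v, hv, rfl⟩, rfl⟩, ?_⟩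
    have heval : ∀ z : K, NormedSpace.exp v z = Real.exp (v z) := fun z => by
      rw [Real.exp_eq_exp_ℝ]
      exact NormedSpace.map_exp (ContinuousMap.evalAlgHom ℝ ℝ z)
        (ContinuousMap.evalCLM ℝ z).continuous v
    simpa [heval] using hne
  rw [eq_top_iff]
  intro f _
  have hf := ContinuousMap.continuousMap_mem_subalgebra_closure_of_separatesPoints _ hsep f
  exact closure_minimal (s := (Algebra.adjoin ℝ (S : Set C(K, ℝ)) : Set C(K, ℝ))) hle hM hf

end Approximation

/-- Integration of continuous functions, as a map into functions on a set of measures. -/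
noncomputable def integralMap {Ω : Type*} [TopologicalSpace Ω] [CompactSpace Ω]
    [MeasurableSpace Ω] [OpensMeasurableSpace Ω] (P : Set (ProbabilityMeasure Ω)) :
    C(Ω, ℝ) →ₗ[ℝ] C(P, ℝ) where
  toFun u := ⟨fun p => ∫ x, u x ∂((p : ProbabilityMeasure Ω) : Measure Ω),
    (ProbabilityMeasure.continuous_integral_boundedContinuousFunction
      (BoundedContinuousFunction.mkOfCompact u)).comp continuous_subtype_val⟩
  map_add' u v := by
    ext p
    exact integral_add ((BoundedContinuousFunction.mkOfCompact u).integrable _)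
      ((BoundedContinuousFunction.mkOfCompact v).integrable _)
  map_smul' c u := by
    ext p
    exact integral_const_mul c _

theorem integralMap_apply {Ω : Type*} [TopologicalSpace Ω] [CompactSpace Ω]
    [MeasurableSpace Ω] [OpensMeasurableSpace Ω] (P : Set (ProbabilityMeasure Ω)) (u : C(Ω, ℝ))
    (p : P) : integralMap P u p = ∫ x, u x ∂((p : ProbabilityMeasure Ω) : Measure Ω) := rfl

/-- A dense subspace of continuous functions distinguishes probability measures. -/
theorem exists_integralMap_ne {Ω : Type*} [TopologicalSpace Ω] [CompactSpace Ω]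
    [MeasurableSpace Ω] [BorelSpace Ω] [HasOuterApproxClosed Ω] {P : Set (ProbabilityMeasure Ω)}
    {U : Submodule ℝ C(Ω, ℝ)} (hU : U.topologicalClosure = ⊤) {p q : P} (hpq : p ≠ q) :
    ∃ u ∈ U, integralMap P u p ≠ integralMap P u q := by
  by_contra! h
  have hcont : ∀ p : P, Continuous fun u : C(Ω, ℝ) => integralMap P u p := fun p =>
    AddMonoidHomClass.continuous_of_bound
      ((ContinuousMap.evalCLM ℝ p).toLinearMap ∘ₗ integralMap P) 1 fun u => by
        have := norm_integral_le_of_norm_le_const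
          (μ := ((p : ProbabilityMeasure Ω) : Measure Ω)) (.of_forall u.norm_coe_le_norm)
        simpa [integralMap_apply] using this
  have hall : ∀ u : C(Ω, ℝ), integralMap P u p = integralMap P u q := fun u =>
    closure_minimal (s := (U : Set C(Ω, ℝ))) h (isClosed_eq (hcont p) (hcont q))
      (show u ∈ U.topologicalClosure from hU ▸ Submodule.mem_top)
  exact hpq (Subtype.ext (Subtype.ext (ext_of_forall_integral_eq_of_IsFiniteMeasure
    (μ := (p.1 : Measure Ω)) (ν := (q.1 : Measure Ω)) fun u =>
    hall u.toContinuousMap)))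

/-- The linear functional with coefficients `w`, restricted to `X`. -/
def coordinateMap {d : ℕ} (X : Set (Fin d → ℝ)) : (Fin d → ℝ) →ₗ[ℝ] C(X, ℝ) where
  toFun w := ⟨fun x => ∑ j, w j * (x : Fin d → ℝ) j,
    continuous_finsetSum _ fun j _ =>
      continuous_const.mul ((continuous_apply j).comp continuous_subtype_val)⟩
  map_add' w w' := by
    ext x
    simp [add_mul, Finset.sum_add_distrib]
  map_smul' c w := by
    ext x
    simp [Finset.mul_sum, mul_assoc]

theorem coordinateMap_apply {d : ℕ} (X : Set (Fin d → ℝ)) (w : Fin d → ℝ) (x : X) :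
    coordinateMap X w x = ∑ j, w j * (x : Fin d → ℝ) j := rfl

/-- Finitely many elements of a span are combinations of one common finite subfamily. -/
theorem Submodule.exists_common_fin_combination {R E ι α : Type*} [Semiring R] [AddCommMonoid E]
    [Module R E] [Fintype α] {s : ι → E} (u : α → E)
    (hu : ∀ a, u a ∈ Submodule.span R (Set.range s)) :
    ∃ (k : ℕ) (i : Fin k → ι) (W : α → Fin k → R), ∀ a, u a = ∑ c, W a c • s (i c) := by
  classical
  choose l hl using fun a => Finsupp.mem_span_range_iff_exists_finsupp.1 (hu a)
  let T : Finset ι := Finset.univ.biUnion fun a => (l a).support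
  refine ⟨T.card, fun c => T.equivFin.symm c, fun a c => l a (T.equivFin.symm c), fun a => ?_⟩
  rw [T.equivFin.symm.sum_comp fun i : T => l a i • s i, Finset.sum_coe_sort T fun i => l a i • s i,
    ← hl a]
  exact Finsupp.sum_of_support_subset _
    (Finset.subset_biUnion_of_mem (fun a => (l a).support) (Finset.mem_univ a)) _ (by simp)

/-- Density of three-layer multi-instance neural networks (two nonlinear layers
with a mean/integration layer in between, followed by a linear output layer) in
C(P, ℝ), where P is a compact (weak-*) set of Borel probability measures on a
compact X ⊆ ℝ^d and σ is continuous and non-polynomial. -/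
theorem stmt_11 {d : ℕ} (X : Set (Fin d → ℝ)) (hX : IsCompact X)
    (P : Set (ProbabilityMeasure ↥X)) (hP : IsCompact P)
    (σ : ℝ → ℝ) (hσ_cont : Continuous σ)
    (hσ_nonpoly : ¬ ∃ q : Polynomial ℝ, ∀ t : ℝ, σ t = q.eval t)
    (f : ↥P → ℝ) (hf : Continuous f) :
    ∀ ε > 0, ∃ (k m : ℕ)
      (W₃ : Fin k → Fin d → ℝ) (b₃ : Fin k → ℝ)
      (W₂ : Fin m → Fin k → ℝ) (b₂ : Fin m → ℝ)
      (W₁ : Fin m → ℝ) (b₁ : ℝ),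
      ∀ p : ↥P,
        |f p - (b₁ + ∑ a, W₁ a * σ (b₂ a + ∑ c, W₂ a c *
          ∫ x : ↥X, σ (b₃ c + ∑ j, W₃ c j * (x : Fin d → ℝ) j)
            ∂((p : ProbabilityMeasure ↥X) : Measure ↥X)))| < ε := by
  intro ε hε
  have : CompactSpace X := isCompact_iff_compactSpace.1 hX
  have : CompactSpace P := isCompact_iff_compactSpace.1 hP
  let s : C(ℝ, ℝ) := ⟨σ, hσ_cont⟩
  let n₁ : LinearMap.range (coordinateMap X) × ℝ → C(X, ℝ) := fun a =>
    s.comp ((a.1 : C(X, ℝ)) + ContinuousMap.const X a.2)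
  have hU : (Submodule.span ℝ (Set.range n₁)).topologicalClosure = ⊤ :=
    dense_span_comp_add_const hσ_nonpoly _ fun x y hxy => by
      obtain ⟨j, hj⟩ := Function.ne_iff.1 fun h => hxy (Subtype.ext h)
      exact ⟨_, ⟨Pi.single j 1, rfl⟩, by simpa [coordinateMap_apply, Pi.single_apply] using hj⟩
  have hV := dense_span_comp_add_const (σ := s) hσ_nonpoly
    ((Submodule.span ℝ (Set.range n₁)).map (integralMap P)) fun p q hpq => by
      obtain ⟨u, hu, hne⟩ := exists_integralMap_ne hU hpq
      exact ⟨_, Submodule.mem_map_of_mem hu, hne⟩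
  have hf' : (⟨f, hf⟩ : C(P, ℝ)) ∈ Submodule.topologicalClosure _ := hV ▸ Submodule.mem_top
  obtain ⟨g, hg, hfg⟩ := Metric.mem_closure_iff.1 hf' ε hε
  obtain ⟨m, i, W₁, hW₁⟩ := Submodule.exists_common_fin_combination (fun _ : Unit => g) fun _ => hg
  choose u hu hui using fun a => (i a).1.2
  obtain ⟨k, l, W₂, hW₂⟩ := Submodule.exists_common_fin_combination u hu
  choose W₃ hW₃ using fun c => (l c).1.2
  refine ⟨k, m, W₃, fun c => (l c).2, W₂, fun a => (i a).2, W₁ (), 0, fun p => ?_⟩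
  have h₁ : ∀ c, ∫ x : X, σ ((l c).2 + ∑ j, W₃ c j * (x : Fin d → ℝ) j)
      ∂((p : ProbabilityMeasure X) : Measure X) = integralMap P (n₁ (l c)) p := fun c => by
    simp [integralMap_apply, n₁, s, ← hW₃, coordinateMap_apply, add_comm]
  have h₂ : ∀ a, ∑ c, W₂ a c * integralMap P (n₁ (l c)) p = (i a).1.1 p := fun a => by
    rw [← hui, hW₂]
    simp
  have h₃ : g p = ∑ a, W₁ () a * σ ((i a).2 + (i a).1.1 p) := by
    rw [hW₁ ()]
    simp [s, add_comm]
  simp only [h₁, h₂, zero_add, ← h₃]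
  exact (ContinuousMap.dist_apply_le_dist (f := ⟨f, hf⟩) (g := g) p).trans_lt hfg
end
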